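/- Let g : 𝓜 → S^1 be of the form g = χ̃·ξ·e_θ, where χ̃ is a modified character associated with a primitive Dirichlet character χ modulo P^r (P a monic irreducible, r ≥ 1), ξ is a short interval character, and θ ∈ ℝ. Then for every choice of lexicographic ordering ⟨·⟩ on 𝔽_q[t] with ⟨0⟩ = 0, sup_{N ≥ 1} |Σ_{G ∈ 𝓜, ⟨G⟩ < N} g(G)| = ∞. -/

import Mathlib

open Polynomial Complex Filter
open scoped ENNReal ComplexConjugate

noncomputable section

namespace FFEDP

variable {F : Type} [Field F] [Fintype F] [DecidableEq F]

/-- `f : 𝓜 → ℂ` is completely multiplicative (on monic polynomials). -/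
def CompMultOnMonic (f : F[X] → ℂ) : Prop :=
  f 1 = 1 ∧ ∀ G H : F[X], G.Monic → H.Monic → f (G * H) = f G * f H

/-- `f` takes values in `S¹` on monic polynomials. -/
def UnimodularOnMonic (f : F[X] → ℂ) : Prop :=
  ∀ G : F[X], G.Monic → ‖f G‖ = 1

/-- A Dirichlet character modulo `Q`. -/
structure IsDirichletCharacter (Q : F[X]) (χ : F[X] → ℂ) : Prop where
  map_mul : ∀ A B : F[X], χ (A * B) = χ A * χ B
  exists_ne_zero : ∃ M : F[X], χ M ≠ 0
  periodic : ∀ M : F[X], χ (M + Q) = χ M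
  eq_zero_of_not_coprime : ∀ M : F[X], ¬ IsCoprime M Q → χ M = 0

/-- A primitive Dirichlet character modulo `Q`: not induced by a character of
smaller modulus. -/
def IsPrimitiveDirichletCharacter (Q : F[X]) (χ : F[X] → ℂ) : Prop :=
  IsDirichletCharacter Q χ ∧
    ¬ ∃ (Q' : F[X]) (χ' : F[X] → ℂ), Q' ∣ Q ∧ Q'.natDegree < Q.natDegree ∧
        IsDirichletCharacter Q' χ' ∧ ∀ M : F[X], IsCoprime M Q → χ M = χ' M

def IsPrincipalDirichletCharacter (Q : F[X]) (χ : F[X] → ℂ) : Prop :=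
  IsDirichletCharacter Q χ ∧ ∀ M : F[X], IsCoprime M Q → χ M = 1

/-- the `i`-th highest-degree coefficient of `A` (zero if `i` exceeds the degree). -/
def topCoeff (A : F[X]) (i : ℕ) : F :=
  if i ≤ A.natDegree then A.coeff (A.natDegree - i) else 0

/-- A short interval character whose value depends only on the `ν + 1`
highest-degree coefficients (so its length is at most `ν`). -/
def IsShortIntervalCharacterOfLength (ν : ℕ) (ξ : F[X] → ℂ) : Prop :=
  (∀ A B : F[X], A.Monic → B.Monic → ξ (A * B) = ξ A * ξ B) ∧
    (∃ A : F[X], A.Monic ∧ ξ A ≠ 0) ∧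
    ∀ A B : F[X], A.Monic → B.Monic →
      (∀ i : ℕ, i ≤ ν → topCoeff A i = topCoeff B i) → ξ A = ξ B

def IsShortIntervalCharacter (ξ : F[X] → ℂ) : Prop :=
  ∃ ν : ℕ, IsShortIntervalCharacterOfLength ν ξ

/-- the Archimedean character `e_θ(G) = e(θ · deg G)`. -/
def eTheta (θ : ℝ) (G : F[X]) : ℂ :=
  Complex.exp (2 * (Real.pi : ℂ) * Complex.I * (θ : ℂ) * (G.natDegree : ℂ))

/-- `∑_{G ∈ 𝓜, deg G ≤ N} f(G)`. -/
def longSum (f : F[X] → ℂ) (N : ℕ) : ℂ :=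
  ∑ᶠ G ∈ {G : F[X] | G.Monic ∧ G.natDegree ≤ N}, f G

/-- `∑_{G ∈ 𝓜, deg G < H} f(G)`. -/
def longSumLt (f : F[X] → ℂ) (H : ℕ) : ℂ :=
  ∑ᶠ G ∈ {G : F[X] | G.Monic ∧ G.natDegree < H}, f G

/-- `∑_{G ∈ I_H(G₀)} f(G)` where `I_H(G₀) = {G ∈ 𝓜 : deg (G - G₀) < H}`. -/
def shortIntervalSum (f : F[X] → ℂ) (H : ℕ) (G₀ : F[X]) : ℂ :=
  ∑ᶠ G ∈ {G : F[X] | G.Monic ∧ (G - G₀).degree < (H : WithBot ℕ)}, f G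

/-- the short sum discrepancy
`𝒮_f = limsup_{H → ∞} limsup_{N → ∞} max_{G₀ ∈ 𝓜_N} |∑_{G ∈ I_H(G₀)} f(G)|`,
as an extended nonnegative real. -/
def shortSumDisc (f : F[X] → ℂ) : ℝ≥0∞ :=
  Filter.limsup (fun H : ℕ =>
    Filter.limsup (fun N : ℕ =>
      ⨆ G₀ ∈ {G₀ : F[X] | G₀.Monic ∧ G₀.natDegree = N},
        (‖shortIntervalSum f H G₀‖₊ : ℝ≥0∞)) Filter.atTop) Filter.atTop

/-- the pretentious distance `𝔻(f, g; N)`. -/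
def pretDist (f g : F[X] → ℂ) (N : ℕ) : ℝ :=
  Real.sqrt (∑ᶠ P ∈ {P : F[X] | P.Monic ∧ Irreducible P ∧ P.natDegree ≤ N},
    ((Fintype.card F : ℝ) ^ P.natDegree)⁻¹ * (1 - (f P * conj (g P)).re))

/-- `ω(Q)`: the number of distinct monic irreducible divisors of `Q`. -/
def omegaPoly (Q : F[X]) : ℕ :=
  Set.ncard {P : F[X] | P.Monic ∧ Irreducible P ∧ P ∣ Q}

/-- `f` is a modified character associated with the character `χ` of modulus `Q`:
it is completely multiplicative, takes values in `S¹` on monics, and agrees with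
`χ` at every monic irreducible not dividing `Q`. -/
def IsModifiedCharacter (Q : F[X]) (χ f : F[X] → ℂ) : Prop :=
  CompMultOnMonic f ∧ UnimodularOnMonic f ∧ IsDirichletCharacter Q χ ∧
    ∀ P : F[X], P.Monic → Irreducible P → ¬ P ∣ Q → f P = χ P

/-- the lexicographic ordering `⟨·⟩` associated with `ι : 𝔽_q → {0,…,q-1}`:
`⟨Σ bᵢ tⁱ⟩ = Σ ι(bᵢ) qⁱ`. -/
def lexNum (ι : F → ℕ) (G : F[X]) : ℕ :=
  ∑ i ∈ Finset.range (G.natDegree + 1), ι (G.coeff i) * (Fintype.card F) ^ i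

set_option linter.unusedSectionVars false

theorem lexNum_eq_sum_range (ι : F → ℕ) (hι0 : ι 0 = 0) (G : F[X]) {N : ℕ}
    (hN : G.degree < N) :
    lexNum ι G = ∑ i ∈ Finset.range N, ι (G.coeff i) * (Fintype.card F) ^ i := by
  have h1 : ∀ M : ℕ, G.degree < M →
      ∑ i ∈ Finset.range M, ι (G.coeff i) * (Fintype.card F) ^ i =
        ∑ i ∈ Finset.range (max M N), ι (G.coeff i) * (Fintype.card F) ^ i := by
    intro M hM
    refine Finset.sum_subset (by simp) fun i _ hi => ?_
    rw [coeff_eq_zero_of_degree_lt (hM.trans_le ?_), hι0, zero_mul]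
    simpa using hi
  have h2 : G.degree < ((G.natDegree + 1 : ℕ) : WithBot ℕ) :=
    degree_le_natDegree.trans_lt (by exact_mod_cast Nat.lt_succ_self _)
  rw [lexNum, h1 _ h2]
  refine (Finset.sum_subset (by simp) fun i _ hi => ?_).symm
  rw [coeff_eq_zero_of_degree_lt (hN.trans_le ?_), hι0, zero_mul]
  simpa using hi

theorem lexNum_mul_X_pow_add (ι : F → ℕ) (hι0 : ι 0 = 0) (A B : F[X]) {h : ℕ}
    (hB : B.degree < h) :
    lexNum ι (A * X ^ h + B) = lexNum ι A * Fintype.card F ^ h + lexNum ι B := by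
  have hA : A.degree < ((A.natDegree + 1 : ℕ) : WithBot ℕ) :=
    degree_le_natDegree.trans_lt (by exact_mod_cast Nat.lt_succ_self _)
  have hdeg : (A * X ^ h + B).degree < ((h + (A.natDegree + 1) : ℕ) : WithBot ℕ) := by
    rw [degree_lt_iff_coeff_zero]
    intro m hm
    have hm' : h ≤ m := by omega
    rw [coeff_add, coeff_mul_X_pow', if_pos hm',
      coeff_eq_zero_of_natDegree_lt (by omega),
      coeff_eq_zero_of_degree_lt (hB.trans_le (by exact_mod_cast hm')), add_zero]
  rw [lexNum_eq_sum_range ι hι0 _ hdeg, lexNum_eq_sum_range ι hι0 _ hB,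
    lexNum_eq_sum_range ι hι0 _ hA, Finset.sum_range_add, add_comm, Finset.sum_mul]
  congr 1
  · refine Finset.sum_congr rfl fun i _ => ?_
    rw [coeff_add, coeff_mul_X_pow', if_pos (by omega), Nat.add_sub_cancel_left,
      coeff_eq_zero_of_degree_lt (hB.trans_le (by exact_mod_cast Nat.le_add_right h i)), add_zero,
      pow_add]
    ring
  · refine Finset.sum_congr rfl fun i hi => ?_
    rw [coeff_add, coeff_mul_X_pow', if_neg (by simpa using hi), zero_add]

theorem lexNum_lt_pow_iff (ι : F → ℕ) (hιinj : Function.Injective ι)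
    (hιlt : ∀ a : F, ι a < Fintype.card F) (hι0 : ι 0 = 0) (G : F[X]) (h : ℕ) :
    lexNum ι G < Fintype.card F ^ h ↔ G.degree < h := by
  constructor
  · intro hlt
    by_contra hdeg
    have hG : G ≠ 0 := by rintro rfl; exact hdeg (by simp [bot_lt_iff_ne_bot])
    rw [degree_eq_natDegree hG] at hdeg
    have hle : h ≤ G.natDegree := by simpa using hdeg
    have hpos : 1 ≤ ι (G.coeff G.natDegree) := by
      rw [Nat.one_le_iff_ne_zero, ← hι0]
      exact fun H => leadingCoeff_ne_zero.2 hG (hιinj H)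
    have := Finset.single_le_sum (f := fun i => ι (G.coeff i) * (Fintype.card F) ^ i)
      (fun _ _ => Nat.zero_le _) (Finset.self_mem_range_succ G.natDegree)
    have h3 : Fintype.card F ^ h ≤ Fintype.card F ^ G.natDegree :=
      Nat.pow_le_pow_right Fintype.card_pos hle
    have h4 : Fintype.card F ^ G.natDegree ≤ lexNum ι G :=
      (Nat.le_mul_of_pos_left _ hpos).trans this
    omega
  · intro hdeg
    rw [lexNum_eq_sum_range ι hι0 G hdeg]
    clear hdeg
    induction h with
    | zero => simp
    | succ h ih =>
      rw [Finset.sum_range_succ]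
      calc _ < Fintype.card F ^ h + ι (G.coeff h) * Fintype.card F ^ h := by omega
        _ = (ι (G.coeff h) + 1) * Fintype.card F ^ h := by ring
        _ ≤ Fintype.card F * Fintype.card F ^ h := Nat.mul_le_mul_right _ (hιlt _)
        _ = _ := by ring

theorem lexNum_C (ι : F → ℕ) (a : F) : lexNum ι (C a) = ι a := by
  simp [lexNum]

theorem lexNum_bijective (ι : F → ℕ) (hιinj : Function.Injective ι)
    (hιlt : ∀ a : F, ι a < Fintype.card F) (hι0 : ι 0 = 0) :
    Function.Bijective (lexNum ι) := by
  have hq : 1 < Fintype.card F := Fintype.one_lt_card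
  have hrec : ∀ (A : F[X]) (b : F),
      lexNum ι (A * X + C b) = lexNum ι A * Fintype.card F + ι b := by
    intro A b
    have := lexNum_mul_X_pow_add ι hι0 A (C b) (h := 1)
      (degree_C_le.trans_lt (by norm_num))
    simpa [lexNum_C] using this
  have hsurj : ∀ m < Fintype.card F, ∃ a, ι a = m := by
    intro m hm
    have hbij : Function.Bijective (fun a => (⟨ι a, hιlt a⟩ : Fin (Fintype.card F))) := by
      rw [Fintype.bijective_iff_injective_and_card]
      exact ⟨fun a b hab => hιinj (by simpa using hab), by simp⟩
    obtain ⟨a, ha⟩ := hbij.2 ⟨m, hm⟩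
    exact ⟨a, by simpa using ha⟩
  constructor
  · have key : ∀ n : ℕ, ∀ G H : F[X], lexNum ι G = n → lexNum ι H = n → G = H := by
      intro n
      induction n using Nat.strong_induction_on with
      | _ n ih =>
        intro G H hG hH
        rcases Nat.eq_zero_or_pos n with rfl | hn
        · have hz : ∀ K : F[X], lexNum ι K = 0 → K = 0 := by
            intro K hK
            have := (lexNum_lt_pow_iff ι hιinj hιlt hι0 K 0).1 (by simp [hK])
            simpa using this
          rw [hz G hG, hz H hH]
        · rw [← divX_mul_X_add G, hrec] at hG
          rw [← divX_mul_X_add H, hrec] at hH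
          have hmod : ι (G.coeff 0) = ι (H.coeff 0) := by
            have h1 := congrArg (· % Fintype.card F) (hG.trans hH.symm)
            simpa [Nat.add_mod, Nat.mod_eq_of_lt (hιlt _)] using h1
          have hdiv : lexNum ι G.divX = lexNum ι H.divX := by
            have h1 := hG.trans hH.symm
            rw [hmod, Nat.add_right_cancel_iff] at h1
            exact Nat.eq_of_mul_eq_mul_right (by omega) h1
          have hlt : lexNum ι G.divX < n := by
            rcases Nat.eq_zero_or_pos (lexNum ι G.divX) with h0 | h0
            · omega
            · nlinarith
          rw [← divX_mul_X_add G, ← divX_mul_X_add H, hιinj hmod,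
            ih _ hlt _ _ rfl hdiv.symm]
    exact fun G H h => key _ G H h rfl
  · intro n
    induction n using Nat.strong_induction_on with
    | _ n ih =>
      rcases Nat.eq_zero_or_pos n with rfl | hn
      · exact ⟨0, by simp [lexNum, hι0]⟩
      · obtain ⟨A, hA⟩ := ih (n / Fintype.card F) (Nat.div_lt_self hn hq)
        obtain ⟨b, hb⟩ := hsurj (n % Fintype.card F) (Nat.mod_lt _ (by omega))
        exact ⟨A * X + C b, by rw [hrec, hA, hb, Nat.div_add_mod']⟩

/-- An enumeration of all polynomials compatible with base `q` digit expansions. -/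
structure IsDigitEnumeration (φ : ℕ → F[X]) : Prop where
  injective : Function.Injective φ
  surjective : Function.Surjective φ
  map_mul_pow_add : ∀ (a h b : ℕ), b < Fintype.card F ^ h →
    φ (a * Fintype.card F ^ h + b) = φ a * X ^ h + φ b
  lt_pow_iff : ∀ n h : ℕ, n < Fintype.card F ^ h ↔ (φ n).degree < h

theorem exists_isDigitEnumeration (ι : F → ℕ) (hιinj : Function.Injective ι)
    (hιlt : ∀ a : F, ι a < Fintype.card F) (hι0 : ι 0 = 0) :
    ∃ φ : ℕ → F[X], IsDigitEnumeration φ ∧ ∀ n, lexNum ι (φ n) = n := by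
  let E := Equiv.ofBijective _ (lexNum_bijective ι hιinj hιlt hι0)
  have hE : ∀ n, lexNum ι (E.symm n) = n := E.apply_symm_apply
  have hlt : ∀ n h : ℕ, n < Fintype.card F ^ h ↔ (E.symm n).degree < h := by
    intro n h
    rw [← lexNum_lt_pow_iff ι hιinj hιlt hι0, hE]
  refine ⟨E.symm, ⟨E.symm.injective, E.symm.surjective, fun a h b hb => ?_, hlt⟩, hE⟩
  apply (lexNum_bijective ι hιinj hιlt hι0).1
  rw [lexNum_mul_X_pow_add ι hι0 _ _ ((hlt b h).1 hb), hE, hE, hE]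

namespace IsDigitEnumeration

variable {φ : ℕ → F[X]}

theorem map_zero (hφ : IsDigitEnumeration φ) : φ 0 = 0 := by
  have := (hφ.lt_pow_iff 0 0).1 (by simp)
  simpa using this

theorem map_eq_zero_iff (hφ : IsDigitEnumeration φ) {n : ℕ} : φ n = 0 ↔ n = 0 := by
  rw [← hφ.map_zero, hφ.injective.eq_iff]

theorem X_pow_dvd_iff (hφ : IsDigitEnumeration φ)
    {n e : ℕ} : X ^ e ∣ φ n ↔ Fintype.card F ^ e ∣ n := by
  have hpos : 0 < Fintype.card F ^ e := pow_pos Fintype.card_pos _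
  have hmod : n % Fintype.card F ^ e < Fintype.card F ^ e := Nat.mod_lt _ hpos
  have h := hφ.map_mul_pow_add (n / Fintype.card F ^ e) e _ hmod
  rw [Nat.div_add_mod'] at h
  rw [h, dvd_add_right (dvd_mul_left _ _), Nat.dvd_iff_mod_eq_zero, ← hφ.map_eq_zero_iff]
  refine ⟨fun hd => ?_, fun h0 => h0 ▸ dvd_zero _⟩
  refine eq_zero_of_dvd_of_degree_lt hd ?_
  rw [degree_X_pow]
  exact (hφ.lt_pow_iff _ _).1 hmod

end IsDigitEnumeration

/-- The finite set of polynomials of degree less than `D`. -/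
def lowDegree (F : Type) [Field F] [Fintype F] (D : ℕ) : Finset F[X] :=
  haveI : Finite (degreeLT F D) := Finite.of_equiv _ (degreeLTEquiv F D).symm.toEquiv
  (Set.toFinite (degreeLT F D : Set F[X])).toFinset

theorem mem_lowDegree {D : ℕ} {N : F[X]} : N ∈ lowDegree F D ↔ N.degree < D := by
  simp [lowDegree, mem_degreeLT]

theorem IsDigitEnumeration.sum_range_pow {φ : ℕ → F[X]} (hφ : IsDigitEnumeration φ) (D : ℕ)
    (g : F[X] → ℂ) :
    ∑ b ∈ Finset.range (Fintype.card F ^ D), g (φ b) = ∑ N ∈ lowDegree F D, g N := by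
  refine Finset.sum_bij (fun b _ => φ b) ?_ ?_ ?_ (fun _ _ => rfl)
  · intro b hb
    rw [mem_lowDegree, ← hφ.lt_pow_iff]
    simpa using hb
  · intro a _ b _ h
    exact hφ.injective h
  · intro N hN
    obtain ⟨b, rfl⟩ := hφ.surjective N
    rw [mem_lowDegree, ← hφ.lt_pow_iff] at hN
    exact ⟨b, by simpa using hN, rfl⟩

theorem sum_range_mul_blocks (g : ℕ → ℂ) (y m : ℕ) :
    ∑ n ∈ Finset.range (y * m), g n =
      ∑ z ∈ Finset.range y, ∑ b ∈ Finset.range m, g (z * m + b) := by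
  induction y with
  | zero => simp
  | succ y ih => rw [Nat.succ_mul, Finset.sum_range_add, Finset.sum_range_succ, ih]

/-- A function periodic modulo `Q` which is scaled by a nontrivial factor under multiplication
by a unit modulo `Q` has vanishing sum over every complete residue system. -/
theorem sum_complete_residues_eq_zero {Q c : F[X]} (hQ : Q.Monic) (hc : IsCoprime c Q)
    {h : F[X] → ℂ} {ζ : ℂ} (hζ : ζ ≠ 1) (hper : ∀ G K, Q ∣ K → h (G + K) = h G)
    (hmul : ∀ G, h (c * G) = ζ * h G) (G₀ : F[X]) :
    ∑ N ∈ lowDegree F Q.natDegree, h (G₀ + N) = 0 := by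
  have hmod : ∀ A : F[X], Q ∣ A %ₘ Q - A := fun A =>
    ⟨-(A /ₘ Q), by linear_combination modByMonic_add_div A Q⟩
  let σ : F[X] → F[X] := fun N => (c * (G₀ + N) - G₀) %ₘ Q
  have hmaps : Set.MapsTo σ (lowDegree F Q.natDegree) (lowDegree F Q.natDegree) := by
    intro N _
    rw [Finset.mem_coe, mem_lowDegree, ← degree_eq_natDegree hQ.ne_zero]
    exact degree_modByMonic_lt _ hQ
  have hinj : Set.InjOn σ (lowDegree F Q.natDegree) := by
    intro N hN N' hN' hNN
    rw [Finset.mem_coe, mem_lowDegree, ← degree_eq_natDegree hQ.ne_zero] at hN hN'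
    have h1 : Q ∣ c * (N - N') := by
      have h2 := dvd_sub (hmod (c * (G₀ + N') - G₀)) (hmod (c * (G₀ + N) - G₀))
      have h3 : (c * (G₀ + N) - G₀) %ₘ Q = (c * (G₀ + N') - G₀) %ₘ Q := hNN
      rw [h3] at h2
      convert h2 using 1
      ring
    have h4 := eq_zero_of_dvd_of_degree_lt (hc.symm.dvd_of_dvd_mul_left h1)
      ((degree_sub_le _ _).trans_lt (max_lt hN hN'))
    exact sub_eq_zero.1 h4
  have hsurj := Finset.surjOn_of_injOn_of_card_le σ hmaps hinj le_rfl
  have hval : ∀ N, h (G₀ + σ N) = ζ * h (G₀ + N) := by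
    intro N
    rw [← hmul, ← hper (c * (G₀ + N)) _ (hmod (c * (G₀ + N) - G₀))]
    congr 1
    simp only [σ]
    ring
  have hsum : ∑ N ∈ lowDegree F Q.natDegree, ζ * h (G₀ + N) =
      ∑ N ∈ lowDegree F Q.natDegree, h (G₀ + N) :=
    Finset.sum_nbij σ hmaps hinj hsurj fun N _ => (hval N).symm
  rw [← Finset.mul_sum] at hsum
  have : (ζ - 1) * ∑ N ∈ lowDegree F Q.natDegree, h (G₀ + N) = 0 := by
    linear_combination hsum
  exact (mul_eq_zero.1 this).resolve_left (sub_ne_zero.2 hζ)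

/-- A completely multiplicative function on all polynomials, unimodular on monic polynomials, which
agrees away from `P` with a nontrivial character modulo `P ^ (k + 1)`. -/
structure IsTwistedCharacter (P : F[X]) (k : ℕ) (ψ : F[X] → ℂ) : Prop where
  map_zero : ψ 0 = 0
  map_mul : ∀ A B, ψ (A * B) = ψ A * ψ B
  norm_of_monic : ∀ G : F[X], G.Monic → ‖ψ G‖ = 1
  periodic : ∀ A K, ¬ P ∣ A → ψ (A + P ^ (k + 1) * K) = ψ A
  nontrivial : ∃ A : F[X], A.Monic ∧ ¬ P ∣ A ∧ ψ A ≠ 1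

namespace IsTwistedCharacter

variable {P : F[X]} {k : ℕ} {ψ : F[X] → ℂ}

theorem map_one (hψ : IsTwistedCharacter P k ψ) : ψ 1 = 1 := by
  have h1 : ψ 1 ≠ 0 := norm_ne_zero_iff.1 (by rw [hψ.norm_of_monic 1 monic_one]; norm_num)
  have h2 := hψ.map_mul 1 1
  rw [mul_one] at h2
  exact (mul_eq_left₀ h1).1 h2.symm

theorem map_pow (hψ : IsTwistedCharacter P k ψ) (A : F[X]) (n : ℕ) : ψ (A ^ n) = ψ A ^ n := by
  induction n with
  | zero => simp [hψ.map_one]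
  | succ n ih => rw [pow_succ, hψ.map_mul, ih, pow_succ]

theorem ne_zero_of_monic (hψ : IsTwistedCharacter P k ψ) {G : F[X]} (hG : G.Monic) : ψ G ≠ 0 :=
  norm_ne_zero_iff.1 (by rw [hψ.norm_of_monic G hG]; norm_num)

theorem locally_periodic (hψ : IsTwistedCharacter P k ψ) (hirr : Irreducible P) {u : ℕ} {G K : F[X]}
    (hG : ¬ P ^ u ∣ G) (hK : P ^ (u + k) ∣ K) : ψ (G + K) = ψ G := by
  have hG0 : G ≠ 0 := by rintro rfl; exact hG (dvd_zero _)
  obtain ⟨G', hG', hPG⟩ :=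
    (FiniteMultiplicity.of_prime_left hirr.prime hG0).exists_eq_pow_mul_and_not_dvd
  set v := multiplicity P G
  have hv : v < u := by
    by_contra hle
    exact hG ((pow_dvd_pow P (not_lt.1 hle)).trans ⟨G', hG'⟩)
  obtain ⟨K', hK'⟩ := (pow_dvd_pow P (show v + (k + 1) ≤ u + k by omega)).trans hK
  have : G + K = P ^ v * (G' + P ^ (k + 1) * K') := by
    rw [hK', pow_add]
    nth_rewrite 1 [hG']
    ring
  rw [this, hψ.map_mul, hψ.periodic _ _ hPG, ← hψ.map_mul, ← hG']

theorem locally_congr (hψ : IsTwistedCharacter P k ψ) (hirr : Irreducible P) {u : ℕ} {G H : F[X]}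
    (hG : ¬ P ^ u ∣ G) (hK : P ^ (u + k) ∣ H - G) : ψ H = ψ G := by
  rw [← hψ.locally_periodic hirr hG hK, add_sub_cancel]

/-- Self-similarity of short interval sums. -/
theorem sum_short_interval (hψ : IsTwistedCharacter P k ψ)
    (hP : P.Monic) (hirr : Irreducible P) (u : ℕ) (Z : F[X])
    (hZ : (Z * (P ^ u - X ^ (P.natDegree * u))).degree < ((P.natDegree * u : ℕ) : WithBot ℕ)) :
    ∑ N ∈ lowDegree F (P.natDegree * u + k * P.natDegree),
        ψ (Z * X ^ (P.natDegree * u + k * P.natDegree) + N) =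
      ψ P ^ u * ∑ M ∈ lowDegree F (k * P.natDegree), ψ (Z * X ^ (k * P.natDegree) + M) := by
  classical
  set d := P.natDegree with hd
  have hD : d * u + k * d = (P ^ (u + k)).natDegree := by
    rw [hP.natDegree_pow]; ring
  obtain ⟨c, -, hPc, hc⟩ := hψ.nontrivial
  have hcop : IsCoprime c P := ((hirr.coprime_iff_not_dvd).2 hPc).symm
  have hzero : ∑ N ∈ lowDegree F (d * u + k * d),
      (if P ^ u ∣ Z * X ^ (d * u + k * d) + N then 0 else ψ (Z * X ^ (d * u + k * d) + N)) = 0 := by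
    conv_lhs => rw [hD]
    rw [← hD]
    conv_lhs => enter [1]; rw [hD]
    refine sum_complete_residues_eq_zero (h := fun G => if P ^ u ∣ G then 0 else ψ G)
      (hP.pow _) (hcop.pow_right) hc ?_ ?_ _
    · intro G K hK
      have hK' : P ^ u ∣ K := (pow_dvd_pow P (Nat.le_add_right u k)).trans hK
      simp only [dvd_add_left hK']
      split_ifs with hG
      · rfl
      · exact hψ.locally_periodic hirr hG hK
    · intro G
      have hiff : P ^ u ∣ c * G ↔ P ^ u ∣ G :=
        ⟨fun h => (hcop.symm.pow_left).dvd_of_dvd_mul_left h, fun h => h.mul_left c⟩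
      simp only [hiff]
      split_ifs
      · simp
      · exact hψ.map_mul _ _
  have hsplit : ∑ N ∈ lowDegree F (d * u + k * d), ψ (Z * X ^ (d * u + k * d) + N) =
      ∑ N ∈ (lowDegree F (d * u + k * d)).filter
        (fun N => P ^ u ∣ Z * X ^ (d * u + k * d) + N), ψ (Z * X ^ (d * u + k * d) + N) := by
    refine sub_eq_zero.1 (Eq.trans ?_ hzero)
    rw [Finset.sum_filter, ← Finset.sum_sub_distrib]
    refine Finset.sum_congr rfl fun N _ => ?_
    split_ifs <;> simp
  have hdegP : (P ^ u).degree = ((d * u : ℕ) : WithBot ℕ) := by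
    rw [degree_eq_natDegree (hP.pow u).ne_zero, hP.natDegree_pow, mul_comm]
  have herr : (Z * X ^ (k * d) * (P ^ u - X ^ (d * u))).degree <
      ((d * u + k * d : ℕ) : WithBot ℕ) := by
    rw [mul_right_comm, degree_mul, degree_X_pow, Nat.cast_add]
    exact WithBot.add_lt_add_right WithBot.coe_ne_bot hZ
  have hmem : ∀ M : F[X], (P ^ u * M).degree < ((d * u + k * d : ℕ) : WithBot ℕ) ↔
      M.degree < ((k * d : ℕ) : WithBot ℕ) := by
    intro M
    rw [degree_mul, hdegP, Nat.cast_add]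
    exact WithBot.add_lt_add_iff_left WithBot.coe_ne_bot
  rw [hsplit, Finset.mul_sum]
  symm
  refine Finset.sum_bij
    (fun M _ => P ^ u * (Z * X ^ (k * d) + M) - Z * X ^ (d * u + k * d)) ?_ ?_ ?_ ?_
  · intro M hM
    rw [mem_lowDegree, ← hmem] at hM
    rw [Finset.mem_filter, mem_lowDegree, add_sub_cancel]
    refine ⟨?_, dvd_mul_right _ _⟩
    have : P ^ u * (Z * X ^ (k * d) + M) - Z * X ^ (d * u + k * d) =
        P ^ u * M + Z * X ^ (k * d) * (P ^ u - X ^ (d * u)) := by rw [pow_add]; ring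
    rw [this]
    exact (degree_add_le _ _).trans_lt (max_lt hM herr)
  · intro M _ M' _ h
    exact add_left_cancel (mul_left_cancel₀ (hP.pow u).ne_zero (sub_left_injective h))
  · intro N hN
    rw [Finset.mem_filter, mem_lowDegree] at hN
    obtain ⟨hN, M, hM⟩ := hN
    refine ⟨M - Z * X ^ (k * d), ?_, ?_⟩
    · rw [mem_lowDegree, ← hmem]
      have : P ^ u * (M - Z * X ^ (k * d)) =
          N - Z * X ^ (k * d) * (P ^ u - X ^ (d * u)) := by
        rw [mul_sub, ← hM, pow_add]; ring
      rw [this]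
      exact (degree_sub_le _ _).trans_lt (max_lt hN herr)
    · rw [add_sub_cancel, ← hM, add_sub_cancel_left]
  · intro M _
    rw [add_sub_cancel, hψ.map_mul, hψ.map_pow]

/-- Self-similarity of the partial sums of `ψ` along a digit enumeration. -/
theorem sum_range_mul_pow (hψ : IsTwistedCharacter P k ψ) {φ : ℕ → F[X]} (hφ : IsDigitEnumeration φ)
    (hP : P.Monic) (hirr : Irreducible P) (u y : ℕ) (hy : Fintype.card F ^ (k * P.natDegree) ∣ y)
    (hsmall : ∀ z ≤ y,
      (φ z * (P ^ u - X ^ (P.natDegree * u))).degree < ((P.natDegree * u : ℕ) : WithBot ℕ)) :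
    ∑ n ∈ Finset.range (y * Fintype.card F ^ (P.natDegree * u)), ψ (φ n) =
      ψ P ^ u * ∑ n ∈ Finset.range y, ψ (φ n) := by
  obtain ⟨x, rfl⟩ := hy
  have hq : 0 < Fintype.card F ^ (k * P.natDegree) := pow_pos Fintype.card_pos _
  rw [show Fintype.card F ^ (k * P.natDegree) * x * Fintype.card F ^ (P.natDegree * u) =
      x * Fintype.card F ^ (P.natDegree * u + k * P.natDegree) by rw [pow_add]; ring,
    mul_comm _ x, sum_range_mul_blocks, sum_range_mul_blocks, Finset.mul_sum]
  have hblock : ∀ z D : ℕ, ∑ b ∈ Finset.range (Fintype.card F ^ D),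
      ψ (φ (z * Fintype.card F ^ D + b)) = ∑ N ∈ lowDegree F D, ψ (φ z * X ^ D + N) := by
    intro z D
    rw [← hφ.sum_range_pow D fun N => ψ (φ z * X ^ D + N)]
    refine Finset.sum_congr rfl fun b hb => ?_
    rw [hφ.map_mul_pow_add z D b (by simpa using hb)]
  refine Finset.sum_congr rfl fun z hz => ?_
  rw [hblock, hblock]
  refine hψ.sum_short_interval hP hirr u (φ z) (hsmall z ?_)
  have := Finset.mem_range.1 hz
  nlinarith

end IsTwistedCharacter

theorem exists_pow_near_one {z : ℂ} (hz : ‖z‖ = 1) {δ : ℝ} (hδ : 0 < δ) :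
    ∃ l : ℕ, 1 ≤ l ∧ ‖z ^ l - 1‖ < δ := by
  let x : Circle := ⟨z, mem_sphere_zero_iff_norm.2 hz⟩
  have h := (mapClusterPt_one_atTop_pow x).frequently (Metric.ball_mem_nhds 1 hδ)
  obtain ⟨l, hl, hl1⟩ := (h.and_eventually (Filter.eventually_ge_atTop 1)).exists
  refine ⟨l, hl1, ?_⟩
  have hl' : dist ((x ^ l : Circle) : ℂ) ((1 : Circle) : ℂ) < δ := hl
  rw [Circle.coe_pow, Circle.coe_one, dist_eq_norm] at hl'
  exact hl'

theorem exists_pow_dvd_X_pow_sub_one {P : F[X]} (hP : P.Monic) (hirr : Irreducible P)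
    (hX : P ≠ X) (s : ℕ) : ∃ m : ℕ, 1 ≤ m ∧ P ^ s ∣ X ^ m - 1 := by
  have hcop : IsCoprime (P ^ s) X := by
    refine IsCoprime.pow_left ((hirr.coprime_iff_not_dvd).2 fun hd => hX ?_)
    exact eq_of_monic_of_associated hP monic_X (hirr.associated_of_dvd irreducible_X hd)
  obtain ⟨i, j, hij, h⟩ := Finite.exists_ne_map_eq_of_infinite
    (fun i : ℕ => (⟨X ^ i %ₘ P ^ s, by
      rw [mem_lowDegree, ← degree_eq_natDegree (hP.pow s).ne_zero]
      exact degree_modByMonic_lt _ (hP.pow s)⟩ : lowDegree F (P ^ s).natDegree))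
  have key : ∀ i j : ℕ, i < j → X ^ i %ₘ P ^ s = X ^ j %ₘ P ^ s →
      ∃ m : ℕ, 1 ≤ m ∧ P ^ s ∣ X ^ m - 1 := by
    intro i j hij h
    refine ⟨j - i, by omega, (hcop.pow_right (n := i)).dvd_of_dvd_mul_left ?_⟩
    have h1 := modByMonic_add_div (X ^ i : F[X]) (P ^ s)
    have h2 := modByMonic_add_div (X ^ j : F[X]) (P ^ s)
    refine ⟨X ^ j /ₘ P ^ s - X ^ i /ₘ P ^ s, ?_⟩
    rw [mul_sub, ← pow_add, Nat.add_sub_cancel' hij.le, mul_one]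
    rw [h] at h1
    linear_combination h1 - h2
  have h' : X ^ i %ₘ P ^ s = X ^ j %ₘ P ^ s := congrArg Subtype.val h
  rcases lt_or_gt_of_ne hij with hlt | hlt
  · exact key i j hlt h'
  · exact key j i hlt h'.symm

/-- Powers of `P` with exponent divisible by a large power of the characteristic
are very close to powers of `X`. -/
theorem degree_pow_sub_X_pow_le {P : F[X]} (hP : P.Monic) (p : ℕ) [Fact p.Prime] [CharP F p]
    (c j : ℕ) (hc : 1 ≤ c) (hd : 1 ≤ P.natDegree) :
    (P ^ (c * p ^ j) - X ^ (P.natDegree * (c * p ^ j))).natDegree + p ^ j ≤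
      P.natDegree * (c * p ^ j) := by
  have h1 : P ^ (c * p ^ j) - X ^ (P.natDegree * (c * p ^ j)) =
      (P ^ c - X ^ (P.natDegree * c)) ^ p ^ j := by
    rw [sub_pow_char_pow, ← pow_mul, ← pow_mul, mul_assoc]
  have hdc : 1 ≤ P.natDegree * c := Nat.one_le_iff_ne_zero.2 (by positivity)
  have h2 : (P ^ c - X ^ (P.natDegree * c)).natDegree < P.natDegree * c := by
    by_cases h0 : P ^ c - X ^ (P.natDegree * c) = 0
    · rw [h0, natDegree_zero]; omega
    · rw [natDegree_lt_iff_degree_lt h0]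
      have hdeg : (P ^ c).degree = ((P.natDegree * c : ℕ) : WithBot ℕ) := by
        rw [degree_eq_natDegree (hP.pow c).ne_zero, hP.natDegree_pow, mul_comm]
      rw [← hdeg]
      refine degree_sub_lt_left ?_ (hP.pow c).ne_zero ?_
      · rw [hdeg, degree_X_pow]
      · rw [(hP.pow c).leadingCoeff, (monic_X_pow _).leadingCoeff]
  rw [h1]
  have h3 := natDegree_pow_le (p := P ^ c - X ^ (P.natDegree * c)) (n := p ^ j)
  have h4 : p ^ j * ((P ^ c - X ^ (P.natDegree * c)).natDegree + 1) ≤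
      p ^ j * (P.natDegree * c) := Nat.mul_le_mul_left _ h2
  nlinarith

/-- A sequence which can repeatedly be moved approximately by a fixed nonzero amount
is unbounded. -/
theorem unbounded_of_approx_steps {Good : ℕ → Prop} {Φ : ℕ → ℂ} {κ : ℂ} (hκ : κ ≠ 0)
    (hne : ∃ y, Good y)
    (hstep : ∀ y, Good y → ∀ δ : ℝ, 0 < δ → ∃ y', Good y' ∧ ‖Φ y' - Φ y - κ‖ < δ) (C : ℝ) :
    ∃ y, Good y ∧ C < ‖Φ y‖ := by
  obtain ⟨y₀, hy₀⟩ := hne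
  have hpos : 0 < ‖κ‖ := norm_pos_iff.2 hκ
  have key : ∀ J : ℕ, ∃ y, Good y ∧ ‖Φ y - Φ y₀ - J * κ‖ ≤ J * (‖κ‖ / 2) := by
    intro J
    induction J with
    | zero => exact ⟨y₀, hy₀, by simp⟩
    | succ J ih =>
      obtain ⟨y, hy, hb⟩ := ih
      obtain ⟨y', hy', hb'⟩ := hstep y hy (‖κ‖ / 2) (by linarith)
      refine ⟨y', hy', ?_⟩
      have : Φ y' - Φ y₀ - (J + 1 : ℕ) * κ =
          (Φ y' - Φ y - κ) + (Φ y - Φ y₀ - J * κ) := by push_cast; ring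
      rw [this]
      refine (norm_add_le _ _).trans ?_
      push_cast
      linarith
  obtain ⟨J, hJ⟩ := exists_nat_gt ((C + ‖Φ y₀‖) / (‖κ‖ / 2))
  rw [div_lt_iff₀ (by linarith)] at hJ
  obtain ⟨y, hy, hb⟩ := key J
  refine ⟨y, hy, ?_⟩
  have h1 : ‖(J : ℂ) * κ‖ = J * ‖κ‖ := by simp
  have h2 : (J : ℂ) * κ = Φ y - Φ y₀ - (Φ y - Φ y₀ - J * κ) := by ring
  have h3 : ‖(J : ℂ) * κ‖ ≤ ‖Φ y‖ + ‖Φ y₀‖ + ‖Φ y - Φ y₀ - J * κ‖ := by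
    rw [h2]
    refine (norm_sub_le _ _).trans ?_
    rw [← h2]
    gcongr
    exact norm_sub_le _ _
  rw [h1] at h3
  linarith

/-- The indices `y` whose digit expansion starts with that of `x₀`, is divisible by `q ^ e`, and for
which the partial sum `Φ` up to the first index with prefix `x₀` is as large as `Φ x₀`. -/
def HasPrefix (F : Type) [Fintype F] (e : ℕ) (Φ : ℕ → ℂ) (x₀ y : ℕ) : Prop :=
  Fintype.card F ^ e ∣ y ∧ ∃ K : ℕ, x₀ * Fintype.card F ^ K ≤ y ∧
    y < (x₀ + 1) * Fintype.card F ^ K ∧ ‖Φ (x₀ * Fintype.card F ^ K)‖ = ‖Φ x₀‖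

namespace IsTwistedCharacter

variable {P : F[X]} {k : ℕ} {ψ : F[X] → ℂ}

theorem exists_shift (hψ : IsTwistedCharacter P k ψ) {φ : ℕ → F[X]} (hφ : IsDigitEnumeration φ)
    (hP : P.Monic) (hirr : Irreducible P) (y s L : ℕ) {δ : ℝ} (hδ : 0 < δ) :
    ∃ u : ℕ, L ≤ u ∧ (P ≠ X → P ^ s ∣ X ^ (P.natDegree * u) - 1) ∧ ‖ψ P ^ u - 1‖ < δ ∧
      ∀ y' ≤ y, Fintype.card F ^ (k * P.natDegree) ∣ y' →
        ∑ n ∈ Finset.range (y' * Fintype.card F ^ (P.natDegree * u)), ψ (φ n) =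
          ψ P ^ u * ∑ n ∈ Finset.range y', ψ (φ n) := by
  obtain ⟨p, hp⟩ := CharP.exists F
  have : Fact p.Prime := ⟨CharP.char_is_prime F p⟩
  have hq : 1 < Fintype.card F := Fintype.one_lt_card
  obtain ⟨m, hm1, hm⟩ : ∃ m : ℕ, 1 ≤ m ∧ (P ≠ X → P ^ s ∣ X ^ m - 1) := by
    by_cases hX : P = X
    · exact ⟨1, le_rfl, fun h => absurd hX h⟩
    · obtain ⟨m, h1, h2⟩ := exists_pow_dvd_X_pow_sub_one hP hirr hX s
      exact ⟨m, h1, fun _ => h2⟩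
  have hp1 : y + L < p ^ (y + L) := Nat.lt_pow_self (Fact.out : p.Prime).one_lt
  obtain ⟨l, hl1, hl⟩ := exists_pow_near_one (z := ψ P ^ (m * p ^ (y + L)))
    (by rw [norm_pow, hψ.norm_of_monic P hP, one_pow]) hδ
  have hml : 1 ≤ m * l := Nat.mul_pos hm1 hl1
  have hle : p ^ (y + L) ≤ m * l * p ^ (y + L) := Nat.le_mul_of_pos_left _ hml
  refine ⟨m * l * p ^ (y + L), by omega, fun hX => (hm hX).trans ?_, ?_, ?_⟩
  · have : P.natDegree * (m * l * p ^ (y + L)) = m * (P.natDegree * l * p ^ (y + L)) := by ring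
    rw [this, pow_mul]
    simpa using sub_dvd_pow_sub_pow (X ^ m : F[X]) 1 (P.natDegree * l * p ^ (y + L))
  · rwa [← pow_mul, mul_right_comm] at hl
  · intro y' hy' hdvd
    refine hψ.sum_range_mul_pow hφ hP hirr _ y' hdvd fun z hz => ?_
    have hbound := degree_pow_sub_X_pow_le hP p (m * l) (y + L) hml hirr.natDegree_pos
    set E := P ^ (m * l * p ^ (y + L)) - X ^ (P.natDegree * (m * l * p ^ (y + L)))
    have hz1 : (φ z).degree < ((y + 1 : ℕ) : WithBot ℕ) := by
      rw [← hφ.lt_pow_iff]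
      exact (Nat.lt_pow_self hq).trans_le (Nat.pow_le_pow_right (by omega) (by omega))
    by_cases hz0 : φ z = 0
    · rw [hz0, zero_mul, degree_zero]
      exact WithBot.bot_lt_coe _
    · have hz2 : (φ z).natDegree < y + 1 := (natDegree_lt_iff_degree_lt hz0).2 hz1
      refine degree_le_natDegree.trans_lt ?_
      have := natDegree_mul_le (p := φ z) (q := E)
      exact_mod_cast (by omega : (φ z * E).natDegree < P.natDegree * (m * l * p ^ (y + L)))

theorem exists_step (hψ : IsTwistedCharacter P k ψ) {φ : ℕ → F[X]} (hφ : IsDigitEnumeration φ)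
    (hP : P.Monic) (hirr : Irreducible P) {x₀ y : ℕ}
    (hx₀ : Fintype.card F ^ (k * P.natDegree) ∣ x₀)
    (hy : HasPrefix F (k * P.natDegree) (fun y => ∑ n ∈ Finset.range y, ψ (φ n)) x₀ y)
    (w s : ℕ) (hw : Fintype.card F ^ (k * P.natDegree) ∣ w) {δ : ℝ} (hδ : 0 < δ) :
    ∃ u y' : ℕ, s ≤ u ∧ (P ≠ X → P ^ s ∣ X ^ (P.natDegree * u) - 1) ∧ ‖ψ P ^ u - 1‖ < δ ∧
      HasPrefix F (k * P.natDegree) (fun y => ∑ n ∈ Finset.range y, ψ (φ n)) x₀ y' ∧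
      φ y' = φ y * X ^ (P.natDegree * u) + φ w ∧
      ‖∑ n ∈ Finset.range y', ψ (φ n) - ∑ n ∈ Finset.range y, ψ (φ n) -
        ∑ n ∈ Finset.range w, ψ (φ y * X ^ (P.natDegree * u) + φ n)‖ < δ := by
  have hq : 1 < Fintype.card F := Fintype.one_lt_card
  have hd : 1 ≤ P.natDegree := hirr.natDegree_pos
  set S := ∑ n ∈ Finset.range y, ψ (φ n) with hS
  have hS1 : 0 < ‖S‖ + 1 := by positivity
  obtain ⟨u, hLu, hXu, hu, hsum⟩ := hψ.exists_shift hφ hP hirr y s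
    (s + w + k * P.natDegree) (lt_min hδ (div_pos hδ hS1))
  obtain ⟨hy1, K, hK1, hK2, hK3⟩ := hy
  have hudu : u ≤ P.natDegree * u := Nat.le_mul_of_pos_left _ hd
  have hwlt : w < Fintype.card F ^ (P.natDegree * u) :=
    (Nat.lt_pow_self hq).trans_le (Nat.pow_le_pow_right (by omega) (by omega))
  have hsumy : ∑ n ∈ Finset.range (y * Fintype.card F ^ (P.natDegree * u) + w), ψ (φ n) =
      ψ P ^ u * S + ∑ n ∈ Finset.range w, ψ (φ y * X ^ (P.natDegree * u) + φ n) := by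
    rw [Finset.sum_range_add, hsum y le_rfl hy1]
    congr 1
    refine Finset.sum_congr rfl fun n hn => ?_
    rw [hφ.map_mul_pow_add _ _ _ ((Finset.mem_range.1 hn).trans hwlt)]
  refine ⟨u, y * Fintype.card F ^ (P.natDegree * u) + w, by omega, hXu,
    hu.trans_le (min_le_left _ _), ⟨dvd_add (hy1.mul_right _) hw, K + P.natDegree * u, ?_, ?_, ?_⟩,
    hφ.map_mul_pow_add _ _ _ hwlt, ?_⟩
  · rw [pow_add, ← mul_assoc]
    exact (Nat.mul_le_mul_right _ hK1).trans (Nat.le_add_right _ _)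
  · rw [pow_add, ← mul_assoc]
    calc _ < (y + 1) * Fintype.card F ^ (P.natDegree * u) := by rw [add_mul, one_mul]; omega
      _ ≤ _ := Nat.mul_le_mul_right _ hK2
  · rw [pow_add, ← mul_assoc]
    simp only at hK3 ⊢
    rw [hsum _ hK1 (hx₀.mul_right _), norm_mul, norm_pow, hψ.norm_of_monic P hP, one_pow, one_mul,
      hK3]
  · rw [hsumy]
    have : ψ P ^ u * S + ∑ n ∈ Finset.range w, ψ (φ y * X ^ (P.natDegree * u) + φ n) - S -
        ∑ n ∈ Finset.range w, ψ (φ y * X ^ (P.natDegree * u) + φ n) = (ψ P ^ u - 1) * S := by ring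
    rw [this, norm_mul]
    have h1 := hu.trans_le (min_le_right _ _)
    rw [lt_div_iff₀ hS1] at h1
    nlinarith [norm_nonneg (ψ P ^ u - 1)]

end IsTwistedCharacter

theorem not_pow_dvd_of_degree_lt {P G : F[X]} (hirr : Irreducible P) (hG : G ≠ 0) {u : ℕ}
    (hdeg : G.degree < u) : ¬ P ^ u ∣ G := by
  intro hd
  refine hG (eq_zero_of_dvd_of_degree_lt hd (hdeg.trans_le ?_))
  rw [degree_pow, degree_eq_natDegree hirr.ne_zero, nsmul_eq_mul, ← Nat.cast_mul, Nat.cast_le]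
  exact Nat.le_mul_of_pos_right _ hirr.natDegree_pos

namespace IsTwistedCharacter

variable {P : F[X]} {k : ℕ} {ψ : F[X] → ℂ}

/-- Adding a multiple of a high power of `P` only changes the cycle sum at its zero element. -/
theorem cycle_sum_add (hψ : IsTwistedCharacter P k ψ)
    {φ : ℕ → F[X]} (hφ : IsDigitEnumeration φ) (hirr : Irreducible P)
    (p : ℕ) [Fact p.Prime] [CharP F p] (e : ℕ) {R : F[X]} (hR : P ^ (e + 1 + k) ∣ R) :
    ∑ j ∈ Finset.range p, ∑ n ∈ Finset.range (Fintype.card F ^ e),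
        ψ (R + j * φ (Fintype.card F ^ e) + φ n) =
      ψ R + ∑ j ∈ Finset.range p, ∑ n ∈ Finset.range (Fintype.card F ^ e),
        ψ (j * φ (Fintype.card F ^ e) + φ n) := by
  have hq : 1 < Fintype.card F := Fintype.one_lt_card
  have hqe : 0 < Fintype.card F ^ e := pow_pos (by omega) _
  have hp0 : 0 < p := (Fact.out : p.Prime).pos
  set W := φ (Fintype.card F ^ e)
  have hW0 : W ≠ 0 := fun h => hqe.ne' (hφ.map_eq_zero_iff.1 h)
  have hWX : X ^ e ∣ W := hφ.X_pow_dvd_iff.2 dvd_rfl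
  have hWdeg : W.degree < ((e + 1 : ℕ) : WithBot ℕ) :=
    (hφ.lt_pow_iff _ _).1 (Nat.pow_lt_pow_right hq (Nat.lt_succ_self e))
  have hterm : ∀ j < p, ∀ n < Fintype.card F ^ e, ¬ (j = 0 ∧ n = 0) →
      ψ (R + j * W + φ n) = ψ (j * W + φ n) := by
    intro j hj n hn hjn
    have hn1 : (φ n).degree < ((e + 1 : ℕ) : WithBot ℕ) :=
      (hφ.lt_pow_iff _ _).1 (hn.trans (Nat.pow_lt_pow_right hq (Nat.lt_succ_self e)))
    have hne : (j : F[X]) * W + φ n ≠ 0 := by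
      intro h0
      have hd : X ^ e ∣ φ n := (dvd_add_right (hWX.mul_left _)).1 (h0 ▸ dvd_zero _)
      have hn0 : n = 0 := Nat.eq_zero_of_dvd_of_lt (hφ.X_pow_dvd_iff.1 hd) hn
      subst hn0
      rw [hφ.map_zero, add_zero] at h0
      have hj0 := (CharP.cast_eq_zero_iff F[X] p j).1 ((mul_eq_zero.1 h0).resolve_right hW0)
      exact hjn ⟨Nat.eq_zero_of_dvd_of_lt hj0 hj, rfl⟩
    have hdeg : ((j : F[X]) * W + φ n).degree < ((e + 1 : ℕ) : WithBot ℕ) := by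
      refine (degree_add_le _ _).trans_lt (max_lt (lt_of_le_of_lt ?_ hWdeg) hn1)
      rw [← nsmul_eq_mul]
      exact degree_smul_le _ _
    refine hψ.locally_congr hirr (not_pow_dvd_of_degree_lt hirr hne hdeg) ?_
    have hsub : R + j * W + φ n - (j * W + φ n) = R := by ring
    rwa [hsub]
  rw [← sub_eq_iff_eq_add, ← Finset.sum_sub_distrib, Finset.sum_eq_single_of_mem 0 (by simpa),
    ← Finset.sum_sub_distrib, Finset.sum_eq_single_of_mem 0 (by simpa)]
  · simp [hφ.map_zero, hψ.map_zero]
  · intro n hn hn0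
    rw [hterm 0 hp0 n (by simpa using hn) (by tauto), sub_self]
  · intro j hj hj0
    rw [sub_eq_zero]
    exact Finset.sum_congr rfl fun n hn =>
      hterm j (by simpa using hj) n (by simpa using hn) (by tauto)

theorem exists_unbounded_of_ne_X (hψ : IsTwistedCharacter P k ψ)
    {φ : ℕ → F[X]} (hφ : IsDigitEnumeration φ)
    (hP : P.Monic) (hirr : Irreducible P) (hX : P ≠ X) (ν : ℕ) :
    ∃ x₀ : ℕ, (φ x₀).Monic ∧ ν ≤ (φ x₀).natDegree ∧ ∀ C : ℝ, ∃ y : ℕ,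
      HasPrefix F (k * P.natDegree) (fun y => ∑ n ∈ Finset.range y, ψ (φ n)) x₀ y ∧
        C < ‖∑ n ∈ Finset.range y, ψ (φ n)‖ := by
  obtain ⟨p, hp⟩ := CharP.exists F
  have : Fact p.Prime := ⟨CharP.char_is_prime F p⟩
  have hq : 1 < Fintype.card F := Fintype.one_lt_card
  set e := k * P.natDegree with he
  have hqe : 0 < Fintype.card F ^ e := pow_pos (by omega) _
  set W := φ (Fintype.card F ^ e) with hW
  have hWdeg : W.degree < ((e + 1 : ℕ) : WithBot ℕ) :=
    (hφ.lt_pow_iff _ _).1 (Nat.pow_lt_pow_right hq (Nat.lt_succ_self e))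
  set Q := P ^ (e + 1 + k) * X ^ (e + ν) with hQ
  have hQm : Q.Monic := (hP.pow _).mul (monic_X_pow _)
  obtain ⟨R, hRm, ⟨B, rfl⟩, hRT⟩ : ∃ R : F[X], R.Monic ∧ Q ∣ R ∧
      ∑ j ∈ Finset.range p, ∑ n ∈ Finset.range (Fintype.card F ^ e), ψ (R + j * W + φ n) ≠ 0 := by
    by_contra hcon
    push Not at hcon
    obtain ⟨A, hAm, -, hA⟩ := hψ.nontrivial
    have h1 := hcon Q hQm dvd_rfl
    have h2 := hcon (Q * A) (hQm.mul hAm) (dvd_mul_right _ _)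
    rw [hψ.cycle_sum_add hφ hirr p e (Dvd.intro _ rfl)] at h1
    rw [hψ.cycle_sum_add hφ hirr p e ((Dvd.intro _ hQ.symm).mul_right A), hψ.map_mul] at h2
    have h3 : ψ Q * (ψ A - 1) = 0 := by linear_combination h2 - h1
    exact (mul_ne_zero (hψ.ne_zero_of_monic hQm) (sub_ne_zero.2 hA)) h3
  set R := Q * B with hR
  have hRdeg : e + 1 + ν ≤ R.natDegree := by
    have hBm : B.Monic := hQm.of_mul_monic_left hRm
    rw [hR, hQm.natDegree_mul hBm, hQ, (hP.pow _).natDegree_mul (monic_X_pow _),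
      hP.natDegree_pow, natDegree_X_pow]
    have : 1 ≤ (e + 1 + k) * P.natDegree := Nat.mul_pos (by omega) hirr.natDegree_pos
    omega
  obtain ⟨x₀, hx₀⟩ := hφ.surjective R
  refine ⟨x₀, hx₀ ▸ hRm, by rw [hx₀]; omega, ?_⟩
  have hx₀d : Fintype.card F ^ e ∣ x₀ := by
    rw [← hφ.X_pow_dvd_iff, hx₀, hR, hQ, pow_add X]
    exact Dvd.dvd.mul_right (Dvd.dvd.mul_left (dvd_mul_right _ _) _) _
  set U := R.natDegree + 1 with hU
  have hvalue : ∀ (j n : ℕ) (H : F[X]), n < Fintype.card F ^ e →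
      P ^ (U + k) ∣ H - (R + j * W) → ψ (H + φ n) = ψ (R + j * W + φ n) := by
    intro j n H hn hH
    have hN : (j * W + φ n).degree < ((e + 1 : ℕ) : WithBot ℕ) := by
      refine (degree_add_le _ _).trans_lt (max_lt (lt_of_le_of_lt ?_ hWdeg) ?_)
      · rw [← nsmul_eq_mul]
        exact degree_smul_le _ _
      · exact (hφ.lt_pow_iff _ _).1 (hn.trans (Nat.pow_lt_pow_right hq (Nat.lt_succ_self e)))
    have hdegR : R.degree = (R.natDegree : WithBot ℕ) := degree_eq_natDegree hRm.ne_zero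
    have hlt : (j * W + φ n).degree < R.degree := by
      rw [hdegR]
      exact hN.trans_le (by exact_mod_cast (by omega))
    have hdeg : (R + j * W + φ n).degree = R.degree := by
      rw [add_assoc, degree_add_eq_left_of_degree_lt hlt]
    refine hψ.locally_congr hirr (u := U) (not_pow_dvd_of_degree_lt hirr ?_ ?_) ?_
    · intro h0
      rw [h0, degree_zero, hdegR] at hdeg
      exact WithBot.bot_ne_coe hdeg
    · rw [hdeg, hdegR]
      exact_mod_cast Nat.lt_succ_self _
    · rwa [add_sub_add_right_eq_sub]
  have hwalk : ∀ (j y : ℕ),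
      HasPrefix F e (fun y => ∑ n ∈ Finset.range y, ψ (φ n)) x₀ y → P ^ (U + k) ∣ φ y - R →
      ∀ δ : ℝ, 0 < δ → ∃ y', HasPrefix F e (fun y => ∑ n ∈ Finset.range y, ψ (φ n)) x₀ y' ∧
        P ^ (U + k) ∣ φ y' - (R + j * W) ∧
        ‖∑ n ∈ Finset.range y', ψ (φ n) - ∑ n ∈ Finset.range y, ψ (φ n) -
          ∑ i ∈ Finset.range j, ∑ n ∈ Finset.range (Fintype.card F ^ e),
            ψ (R + i * W + φ n)‖ < δ := by
    intro j y hy hyR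
    induction j with
    | zero =>
      intro δ hδ
      exact ⟨y, hy, by simpa using hyR, by simpa using hδ⟩
    | succ j ih =>
      intro δ hδ
      obtain ⟨y₁, hy₁, hR₁, hb₁⟩ := ih (δ / 2) (half_pos hδ)
      obtain ⟨u, y₂, -, hu, -, hy₂, hφ₂, hb₂⟩ := hψ.exists_step hφ hP hirr hx₀d hy₁
        (Fintype.card F ^ e) (U + k) dvd_rfl (half_pos hδ)
      have hshift : P ^ (U + k) ∣ φ y₁ * X ^ (P.natDegree * u) - (R + (j : F[X]) * W) := by
        have := dvd_add ((hu hX).mul_left (φ y₁)) hR₁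
        convert this using 1
        ring
      refine ⟨y₂, hy₂, ?_, ?_⟩
      · rw [hφ₂, ← hW]
        convert hshift using 1
        push_cast
        ring
      · rw [Finset.sum_congr rfl fun n hn => hvalue j n _ (Finset.mem_range.1 hn) hshift] at hb₂
        rw [Finset.sum_range_succ]
        refine lt_of_eq_of_lt ?_ ((norm_add_le _ _).trans_lt (add_lt_add hb₁ hb₂)) |>.trans_eq
          (add_halves δ)
        congr 1
        ring
  intro C
  obtain ⟨y, hy, hC⟩ := unbounded_of_approx_steps
    (Good := fun y => HasPrefix F e (fun y => ∑ n ∈ Finset.range y, ψ (φ n)) x₀ y ∧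
      P ^ (U + k) ∣ φ y - R) (Φ := fun y => ∑ n ∈ Finset.range y, ψ (φ n)) hRT
    ⟨x₀, ⟨hx₀d, 0, by simp, by simp, by simp⟩, by simp [hx₀]⟩ (by
      rintro y ⟨hy, hyR⟩ δ hδ
      obtain ⟨y', hy', hyR', hb⟩ := hwalk p y hy hyR δ hδ
      exact ⟨y', ⟨hy', by simpa using hyR'⟩, hb⟩) C
  exact ⟨y, hy.1, hC⟩

end IsTwistedCharacter

namespace IsTwistedCharacter

variable {P : F[X]} {k : ℕ} {ψ : F[X] → ℂ}

/-- For the prime `X`, some partial sum one step past a multiple of `q ^ k` does not vanish. -/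
theorem exists_sum_range_succ_ne_zero (hψ : IsTwistedCharacter P k ψ)
    {φ : ℕ → F[X]} (hφ : IsDigitEnumeration φ) (hX : P = X) :
    ∃ w : ℕ, 0 < w ∧ Fintype.card F ^ k ∣ w ∧ ∑ n ∈ Finset.range (w + 1), ψ (φ n) ≠ 0 := by
  subst hX
  have hq : 1 < Fintype.card F := Fintype.one_lt_card
  by_contra! hcon
  set s := k + k + 1 with hs
  have hqe : 0 < Fintype.card F ^ k := pow_pos (by omega) _
  have hqs : Fintype.card F ^ k < Fintype.card F ^ s := Nat.pow_lt_pow_right hq (by omega)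
  have hdvd : Fintype.card F ^ k ∣ Fintype.card F ^ s := pow_dvd_pow _ (by omega)
  set v := Fintype.card F ^ s - Fintype.card F ^ k with hv
  have hvd : Fintype.card F ^ k ∣ v := Nat.dvd_sub hdvd dvd_rfl
  have key : ∀ m : ℕ, ∑ b ∈ Finset.range (Fintype.card F ^ k - 1), ψ (φ (v + 1 + b)) +
      ψ (φ (m + 1)) * ψ X ^ s = 0 := by
    intro m
    have h1 := hcon (m * Fintype.card F ^ s + v) (by omega) (dvd_add (hdvd.mul_left _) hvd)
    have h2 := hcon ((m + 1) * Fintype.card F ^ s) (by positivity) (hdvd.mul_left _)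
    have hlen : (m + 1) * Fintype.card F ^ s + 1 =
        m * Fintype.card F ^ s + v + 1 + (Fintype.card F ^ k - 1) + 1 := by
      rw [add_mul, one_mul]
      omega
    rw [hlen, Finset.sum_range_succ, Finset.sum_range_add, h1, zero_add] at h2
    rw [← h2]
    congr 1
    · refine Finset.sum_congr rfl fun b hb => ?_
      rw [Finset.mem_range] at hb
      have hlt : v + 1 + b < Fintype.card F ^ s := by omega
      rw [add_assoc (_ * _), add_assoc (_ * _), hφ.map_mul_pow_add m s _ hlt]
      refine (hψ.locally_congr irreducible_X (u := k) ?_ ?_).symm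
      · rw [hφ.X_pow_dvd_iff, add_assoc, Nat.dvd_add_right hvd]
        exact Nat.not_dvd_of_pos_of_lt (by omega) (by omega)
      · rw [add_sub_cancel_right]
        exact (pow_dvd_pow _ (by omega)).mul_left _
    · have hlast : m * Fintype.card F ^ s + v + 1 + (Fintype.card F ^ k - 1) =
          (m + 1) * Fintype.card F ^ s + 0 := by
        rw [add_mul, one_mul]
        omega
      rw [hlast, hφ.map_mul_pow_add _ _ _ (by positivity), hφ.map_zero, add_zero, hψ.map_mul,
        hψ.map_pow]
  obtain ⟨A, hA, -, hA1⟩ := hψ.nontrivial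
  have hval : ∀ B : F[X], B.Monic → ∑ b ∈ Finset.range (Fintype.card F ^ k - 1),
      ψ (φ (v + 1 + b)) + ψ B * ψ X ^ s = 0 := by
    intro B hB
    obtain ⟨m, rfl⟩ := hφ.surjective B
    obtain ⟨m, rfl⟩ := Nat.exists_eq_succ_of_ne_zero
      (fun h => hB.ne_zero (hφ.map_eq_zero_iff.2 h))
    exact key m
  have h3 : (ψ A - 1) * ψ X ^ s = 0 := by
    have h1 := hval 1 monic_one
    rw [hψ.map_one] at h1
    linear_combination hval A hA - h1
  exact mul_ne_zero (sub_ne_zero.2 hA1) (pow_ne_zero _ (hψ.ne_zero_of_monic monic_X)) h3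

theorem exists_unbounded_of_eq_X (hψ : IsTwistedCharacter P k ψ)
    {φ : ℕ → F[X]} (hφ : IsDigitEnumeration φ)
    (hX : P = X) (ν : ℕ) :
    ∃ x₀ : ℕ, (φ x₀).Monic ∧ ν ≤ (φ x₀).natDegree ∧ ∀ C : ℝ, ∃ y : ℕ,
      HasPrefix F (k * P.natDegree) (fun y => ∑ n ∈ Finset.range y, ψ (φ n)) x₀ y ∧
        C < ‖∑ n ∈ Finset.range y, ψ (φ n)‖ := by
  have hq : 1 < Fintype.card F := Fintype.one_lt_card
  obtain ⟨w, hw0, hwd, hκ⟩ := hψ.exists_sum_range_succ_ne_zero hφ hX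
  subst hX
  have hPdeg : k * (X : F[X]).natDegree = k := by rw [natDegree_X, mul_one]
  have hlow : ∀ n, 0 < n → n ≤ w → ¬ (X : F[X]) ^ (w + 1) ∣ φ n := by
    intro n hn hnw
    refine not_pow_dvd_of_degree_lt irreducible_X (fun h => hn.ne' (hφ.map_eq_zero_iff.1 h)) ?_
    rw [← hφ.lt_pow_iff]
    exact (Nat.lt_pow_self hq).trans_le (Nat.pow_le_pow_right (by omega) (by omega))
  have hwdeg : (φ w).degree < ((w + 1 + k + ν : ℕ) : WithBot ℕ) := by
    rw [← hφ.lt_pow_iff]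
    exact (Nat.lt_pow_self hq).trans_le (Nat.pow_le_pow_right (by omega) (by omega))
  have hRm : (X ^ (w + 1 + k + ν) + φ w).Monic := monic_X_pow_add hwdeg
  obtain ⟨x₀, hx₀⟩ := hφ.surjective (X ^ (w + 1 + k + ν) + φ w)
  have hx₀d : Fintype.card F ^ (k * (X : F[X]).natDegree) ∣ x₀ := by
    rw [hPdeg, ← hφ.X_pow_dvd_iff, hx₀]
    exact dvd_add (pow_dvd_pow _ (by omega)) (hφ.X_pow_dvd_iff.2 hwd)
  refine ⟨x₀, hx₀ ▸ hRm, ?_, fun C => ?_⟩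
  · rw [hx₀, natDegree_add_eq_left_of_degree_lt (by rwa [degree_X_pow]), natDegree_X_pow]
    omega
  obtain ⟨y, hy, hC⟩ := unbounded_of_approx_steps
    (Good := fun y => HasPrefix F (k * (X : F[X]).natDegree)
      (fun y => ∑ n ∈ Finset.range y, ψ (φ n)) x₀ y ∧ X ^ (w + 1 + k) ∣ φ y - φ w)
    (Φ := fun y => ∑ n ∈ Finset.range y, ψ (φ n)) hκ
    ⟨x₀, ⟨hx₀d, 0, by simp, by simp, by simp⟩, by
      rw [hx₀, add_sub_cancel_right]
      exact pow_dvd_pow _ (by omega)⟩ (by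
      rintro y ⟨hy, hyw⟩ δ hδ
      have hpos : 0 < ‖ψ (φ w)‖ + 1 := by positivity
      obtain ⟨u, y', hu, -, hψu, hy', hφy', hb⟩ := hψ.exists_step hφ monic_X irreducible_X hx₀d hy w
        (w + 1 + k) (hPdeg.symm ▸ hwd) (lt_min (half_pos hδ) (div_pos (half_pos hδ) hpos))
      rw [natDegree_X, one_mul] at hφy' hb
      refine ⟨y', ⟨hy', ?_⟩, ?_⟩
      · rw [hφy', add_sub_cancel_right]
        exact (pow_dvd_pow _ hu).mul_left _
      · have hsum : ∑ n ∈ Finset.range w, ψ (φ y * X ^ u + φ n) =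
            ∑ n ∈ Finset.range (w + 1), ψ (φ n) + (ψ X ^ u - 1) * ψ (φ w) := by
          obtain ⟨w', rfl⟩ := Nat.exists_eq_add_one_of_ne_zero hw0.ne'
          rw [Finset.sum_range_succ _ (w' + 1), Finset.sum_range_succ' _ w',
            Finset.sum_range_succ' _ w',
            hφ.map_zero, hψ.map_zero, add_zero, add_zero, hψ.map_mul, hψ.map_pow,
            hψ.locally_congr irreducible_X (hlow _ hw0 le_rfl) hyw]
          have hterm : ∀ n ∈ Finset.range w', ψ (φ y * X ^ u + φ (n + 1)) = ψ (φ (n + 1)) := by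
            intro n hn
            rw [Finset.mem_range] at hn
            refine hψ.locally_congr irreducible_X (hlow (n + 1) (by omega) (by omega)) ?_
            rw [add_sub_cancel_right]
            exact (pow_dvd_pow _ hu).mul_left _
          rw [Finset.sum_congr rfl hterm]
          ring
        rw [hsum] at hb
        have h1 := hψu.trans_le (min_le_right _ _)
        rw [lt_div_iff₀ hpos] at h1
        have h2 : ‖(ψ X ^ u - 1) * ψ (φ w)‖ < δ / 2 := by
          rw [norm_mul]
          nlinarith [norm_nonneg (ψ X ^ u - 1)]
        refine lt_of_eq_of_lt ?_ ((norm_add_le _ _).trans_lt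
          (add_lt_add (hb.trans_le (min_le_left _ _)) h2)) |>.trans_eq (add_halves δ)
        congr 1
        ring) C
  exact ⟨y, hy.1, hC⟩

end IsTwistedCharacter

namespace IsDirichletCharacter

variable {P : F[X]} {r : ℕ} {χ : F[X] → ℂ}

theorem map_one {Q : F[X]} (hχ : IsDirichletCharacter Q χ) : χ 1 = 1 := by
  obtain ⟨M, hM⟩ := hχ.exists_ne_zero
  have h := hχ.map_mul M 1
  rw [mul_one] at h
  exact (mul_eq_left₀ hM).1 h.symm

/-- Invariance under translation by `P ^ r` upgrades to invariance under all multiples of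
`P ^ r`, using multiplicativity. -/
theorem map_add_mul (hirr : Irreducible P) (hχ : IsDirichletCharacter (P ^ r) χ) (M K : F[X]) :
    χ (M + K * P ^ r) = χ M := by
  suffices h : ∀ (n : ℕ) (K : F[X]), K.degree < n → ∀ M, χ (M + K * P ^ r) = χ M from
    h (K.natDegree + 1) K (degree_le_natDegree.trans_lt (by exact_mod_cast Nat.lt_succ_self _)) M
  intro n
  induction n with
  | zero =>
    intro K hK M
    rw [Nat.cast_zero] at hK
    rw [degree_eq_bot.1 (Nat.WithBot.lt_zero_iff.1 hK), zero_mul, add_zero]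
  | succ n ih =>
    have hcop : ∀ K : F[X], K.degree < ((n + 1 : ℕ) : WithBot ℕ) → ¬ P ∣ K →
        ∀ M, χ (M + K * P ^ r) = χ M := by
      intro K hK hPK M
      have hK0 : K ≠ 0 := fun h => hPK (h ▸ dvd_zero _)
      have hKn : K.degree ≤ n := by
        rw [degree_eq_natDegree hK0] at hK ⊢
        exact_mod_cast Nat.lt_succ_iff.1 (by exact_mod_cast hK)
      obtain ⟨a, b, hab⟩ : IsCoprime K (P ^ r) :=
        ((hirr.coprime_iff_not_dvd).2 hPK).symm.pow_right
      set B := (-M * b) % K with hB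
      have hBn : B.degree < n := (degree_mod_lt _ hK0).trans_le hKn
      have hdiv := EuclideanDomain.div_add_mod (-M * b) K
      obtain ⟨x, hx⟩ : K ∣ M + B * P ^ r :=
        ⟨M * a - (-M * b / K) * P ^ r, by linear_combination (-M) * hab + P ^ r * hdiv⟩
      have hshift : M + K * P ^ r + B * P ^ r = K * (x + P ^ r) := by linear_combination hx
      rw [← ih B hBn, hshift, hχ.map_mul, hχ.periodic, ← hχ.map_mul, ← hx, ih B hBn]
    intro K hK M
    by_cases hPK : P ∣ K
    · have h1 : ¬ P ∣ K - 1 := fun h => hirr.not_dvd_one ((dvd_sub_right hPK).1 h)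
      have hdeg : (K - 1).degree < ((n + 1 : ℕ) : WithBot ℕ) := by
        refine (degree_sub_le _ _).trans_lt (max_lt hK ?_)
        rw [degree_one]
        exact_mod_cast Nat.succ_pos n
      have hsplit : M + K * P ^ r = M + (K - 1) * P ^ r + P ^ r := by ring
      rw [hsplit, hχ.periodic, hcop _ hdeg h1]
    · exact hcop K hK hPK M

end IsDirichletCharacter

/-- A modified character agrees with its character on monic polynomials coprime to `P`. -/
theorem IsModifiedCharacter.eq_of_not_dvd {P : F[X]} {r : ℕ} {χ f : F[X] → ℂ}
    (hf : IsModifiedCharacter (P ^ r) χ f) (hP : P.Monic) (hirr : Irreducible P) {G : F[X]}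
    (hG : G.Monic) (hPG : ¬ P ∣ G) : f G = χ G := by
  obtain ⟨⟨hf1, hfm⟩, -, hχ, hfχ⟩ := hf
  induction hn : G.natDegree using Nat.strong_induction_on generalizing G with
  | _ n ih =>
    by_cases hu : IsUnit G
    · rw [hG.eq_one_of_isUnit hu, hf1, hχ.map_one]
    · obtain ⟨Q, hQm, hQi, R, rfl⟩ := exists_monic_irreducible_factor G hu
      have hRm : R.Monic := hQm.of_mul_monic_left hG
      have hQP : ¬ Q ∣ P ^ r := fun h => hPG <| by
        have hQ := hQi.prime.dvd_of_dvd_pow h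
        rw [eq_of_monic_of_associated hP hQm (hQi.associated_of_dvd hirr hQ).symm]
        exact dvd_mul_right _ _
      have hlt : R.natDegree < n := by
        rw [← hn, hQm.natDegree_mul hRm]
        have := hQi.natDegree_pos
        omega
      rw [hfm Q R hQm hRm, hχ.map_mul, hfχ Q hQm hQi hQP,
        ih _ hlt hRm (fun h => hPG (h.mul_left _)) rfl]

/-- The extension of a modified character `f` of `χ` to all polynomials which is `χ` on constants. -/
def extendModified (χ f : F[X] → ℂ) (G : F[X]) : ℂ :=
  if G = 0 then 0 else χ (C G.leadingCoeff) * f (C G.leadingCoeff⁻¹ * G)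

theorem extendModified_of_monic {Q : F[X]} {χ f : F[X] → ℂ} (hχ : IsDirichletCharacter Q χ)
    {G : F[X]} (hG : G.Monic) : extendModified χ f G = f G := by
  rw [extendModified, if_neg hG.ne_zero, hG.leadingCoeff, inv_one, C_1, hχ.map_one, one_mul,
    one_mul]

theorem extendModified_of_not_dvd {P : F[X]} {r : ℕ} {χ f : F[X] → ℂ}
    (hf : IsModifiedCharacter (P ^ r) χ f) (hP : P.Monic) (hirr : Irreducible P) {G : F[X]}
    (hPG : ¬ P ∣ G) : extendModified χ f G = χ G := by
  have hG0 : G ≠ 0 := fun h => hPG (h ▸ dvd_zero _)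
  have hl : G.leadingCoeff ≠ 0 := leadingCoeff_ne_zero.2 hG0
  have hmul : C G.leadingCoeff * (C G.leadingCoeff⁻¹ * G) = G := by
    rw [← mul_assoc, ← C_mul, mul_inv_cancel₀ hl, C_1, one_mul]
  have hndvd : ¬ P ∣ C G.leadingCoeff⁻¹ * G := fun h => hPG (hmul ▸ h.mul_left _)
  rw [extendModified, if_neg hG0, hf.eq_of_not_dvd hP hirr
    (monic_C_mul_of_mul_leadingCoeff_eq_one (inv_mul_cancel₀ hl)) hndvd, ← hf.2.2.1.map_mul, hmul]

theorem isTwistedCharacter_extendModified {P : F[X]} {k : ℕ} {χ f : F[X] → ℂ} (hP : P.Monic)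
    (hirr : Irreducible P) (hχ : IsPrimitiveDirichletCharacter (P ^ (k + 1)) χ)
    (hf : IsModifiedCharacter (P ^ (k + 1)) χ f) :
    IsTwistedCharacter P k (extendModified χ f) where
  map_zero := if_pos rfl
  map_mul A B := by
    by_cases hA : A = 0
    · simp [extendModified, hA]
    by_cases hB : B = 0
    · simp [extendModified, hB]
    have hmA := monic_C_mul_of_mul_leadingCoeff_eq_one
      (inv_mul_cancel₀ (leadingCoeff_ne_zero.2 hA))
    have hmB := monic_C_mul_of_mul_leadingCoeff_eq_one
      (inv_mul_cancel₀ (leadingCoeff_ne_zero.2 hB))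
    rw [extendModified, extendModified, extendModified, if_neg hA, if_neg hB,
      if_neg (mul_ne_zero hA hB), leadingCoeff_mul, C_mul, hχ.1.map_mul, mul_inv, C_mul,
      mul_mul_mul_comm, hf.1.2 _ _ hmA hmB]
    ring
  norm_of_monic G hG := by rw [extendModified_of_monic hχ.1 hG, hf.2.1 G hG]
  periodic A K hA := by
    have hAK : ¬ P ∣ A + P ^ (k + 1) * K := fun h =>
      hA ((dvd_add_left ((dvd_pow_self P (Nat.succ_ne_zero k)).mul_right K)).1 h)
    rw [extendModified_of_not_dvd hf hP hirr hA, extendModified_of_not_dvd hf hP hirr hAK,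
      mul_comm, hχ.1.map_add_mul hirr]
  nontrivial := by
    by_contra! hcon
    refine hχ.2 ⟨1, fun _ => 1, one_dvd _, ?_, ⟨?_, ⟨1, one_ne_zero⟩, fun _ => rfl, ?_⟩, ?_⟩
    · rw [natDegree_one, hP.natDegree_pow]
      exact Nat.mul_pos (Nat.succ_pos k) hirr.natDegree_pos
    · simp
    · exact fun M hM => absurd isCoprime_one_right hM
    · intro M hM
      have hPM : ¬ P ∣ M := fun h =>
        hirr.not_isUnit (hM.isUnit_of_dvd' h (dvd_pow_self P (Nat.succ_ne_zero k)))
      have hm : (X ^ (M.natDegree + 1) * P ^ (k + 1)).Monic := (monic_X_pow _).mul (hP.pow _)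
      have hdeg : M.degree < (X ^ (M.natDegree + 1) * P ^ (k + 1)).degree := by
        rw [degree_eq_natDegree hm.ne_zero, (monic_X_pow _).natDegree_mul (hP.pow _),
          natDegree_X_pow]
        exact degree_le_natDegree.trans_lt (by exact_mod_cast (by omega))
      have hndvd : ¬ P ∣ M + X ^ (M.natDegree + 1) * P ^ (k + 1) := fun h =>
        hPM ((dvd_add_left ((dvd_pow_self P (Nat.succ_ne_zero k)).mul_left _)).1 h)
      rw [← hcon _ (hm.add_of_right hdeg) hndvd, extendModified_of_not_dvd hf hP hirr hndvd,
        hχ.1.map_add_mul hirr]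

theorem norm_eTheta (θ : ℝ) (G : F[X]) : ‖eTheta θ G‖ = 1 := by
  have h : 2 * (Real.pi : ℂ) * Complex.I * (θ : ℂ) * (G.natDegree : ℂ) =
      ((2 * Real.pi * θ * G.natDegree : ℝ) : ℂ) * Complex.I := by
    push_cast
    ring
  rw [eTheta, h, Complex.norm_exp_ofReal_mul_I]

/-- Partial sums in the lexicographic order, written along the inverse of `lexNum`. -/
theorem finsum_lexNum_lt {ι : F → ℕ} {φ : ℕ → F[X]} (hφ : IsDigitEnumeration φ)
    (hι : ∀ n, lexNum ι (φ n) = n) (g : F[X] → ℂ) (N : ℕ) :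
    ∑ᶠ G ∈ {G : F[X] | G.Monic ∧ lexNum ι G < N}, g G =
      ∑ n ∈ Finset.range N with (φ n).Monic, g (φ n) := by
  classical
  rw [← Finset.sum_image (f := g) (s := {n ∈ Finset.range N | (φ n).Monic}) (g := φ)
    hφ.injective.injOn, ← finsum_mem_coe_finset]
  congr! 3 with G
  obtain ⟨n, rfl⟩ := hφ.surjective G
  simp [hι, hφ.injective.eq_iff, and_comm]

/-- Polynomials with the same leading block have the same degree and top coefficients. -/
theorem monic_block {R B : F[X]} (hR : R.Monic) {K : ℕ} (hB : B.degree < K) :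
    (R * X ^ K + B).Monic ∧ (R * X ^ K + B).natDegree = R.natDegree + K ∧
      ∀ i ≤ R.natDegree, topCoeff (R * X ^ K + B) i = R.coeff (R.natDegree - i) := by
  have hm : (R * X ^ K).Monic := hR.mul (monic_X_pow _)
  have hnat : (R * X ^ K).natDegree = R.natDegree + K := by
    rw [hR.natDegree_mul (monic_X_pow _), natDegree_X_pow]
  have hdeg : B.degree < (R * X ^ K).degree := by
    rw [degree_eq_natDegree hm.ne_zero, hnat]
    exact hB.trans_le (by exact_mod_cast Nat.le_add_left _ _)
  have hnat' : (R * X ^ K + B).natDegree = R.natDegree + K := by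
    rw [natDegree_add_eq_left_of_degree_lt hdeg, hnat]
  refine ⟨hm.add_of_left hdeg, hnat', fun i hi => ?_⟩
  have hidx : R.natDegree + K - i = R.natDegree - i + K := by omega
  rw [topCoeff, hnat', if_pos (by omega), hidx, coeff_add, coeff_mul_X_pow,
    coeff_eq_zero_of_degree_lt (hB.trans_le (by exact_mod_cast Nat.le_add_left _ _)), add_zero]

/-- for `g = χ̃·ξ·e_θ` with `χ̃` a modified character of prime
power modulus `P^r`, `ξ` a short interval character and `θ ∈ ℝ`, the
lexicographically ordered partial sums of `g` are unbounded, for any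
lexicographic ordering `⟨·⟩` with `⟨0⟩ = 0`. -/
theorem lexicographic_discrepancy_infinite_modified
    (P : F[X]) (r : ℕ) (χ f ξ : F[X] → ℂ) (θ : ℝ)
    (hP : P.Monic) (hirr : Irreducible P) (hr : 1 ≤ r)
    (hχ : IsPrimitiveDirichletCharacter (P ^ r) χ)
    (hf : IsModifiedCharacter (P ^ r) χ f)
    (hξ : IsShortIntervalCharacter ξ)
    (hξ1 : ∀ G : F[X], G.Monic → ‖ξ G‖ = 1)
    (ι : F → ℕ) (hιinj : Function.Injective ι)
    (hιlt : ∀ a : F, ι a < Fintype.card F) (hι0 : ι 0 = 0) :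
    ∀ C : ℝ, ∃ N : ℕ, 1 ≤ N ∧
      C < ‖∑ᶠ G ∈ {G : F[X] | G.Monic ∧ lexNum ι G < N},
            f G * ξ G * eTheta θ G‖ := by
  obtain ⟨k, rfl⟩ : ∃ k, r = k + 1 := ⟨r - 1, by omega⟩
  obtain ⟨φ, hφ, hφι⟩ := exists_isDigitEnumeration ι hιinj hιlt hι0
  obtain ⟨ν, -, -, hξν⟩ := hξ
  set ψ := extendModified χ f
  have hψ : IsTwistedCharacter P k ψ := isTwistedCharacter_extendModified hP hirr hχ hf
  obtain ⟨x₀, hx₀m, hx₀ν, hunb⟩ : ∃ x₀ : ℕ, (φ x₀).Monic ∧ ν ≤ (φ x₀).natDegree ∧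
      ∀ C : ℝ, ∃ y : ℕ, HasPrefix F (k * P.natDegree)
        (fun y => ∑ n ∈ Finset.range y, ψ (φ n)) x₀ y ∧
          C < ‖∑ n ∈ Finset.range y, ψ (φ n)‖ := by
    by_cases hX : P = X
    · exact hψ.exists_unbounded_of_eq_X hφ hX ν
    · exact hψ.exists_unbounded_of_ne_X hφ hP hirr hX ν
  have hx₀1 : 1 ≤ x₀ := Nat.one_le_iff_ne_zero.2 fun h =>
    hx₀m.ne_zero (hφ.map_eq_zero_iff.2 h)
  by_contra! hcon
  obtain ⟨D, hD⟩ := hcon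
  simp only [finsum_lexNum_lt hφ hφι, Finset.sum_filter] at hD
  obtain ⟨y, ⟨-, K, hK1, hK2, hK3⟩, hy⟩ :=
    hunb (2 * D + ‖∑ n ∈ Finset.range x₀, ψ (φ n)‖)
  obtain ⟨z, rfl⟩ := Nat.exists_eq_add_of_le hK1
  have hzK : z < Fintype.card F ^ K := by
    rw [add_mul, one_mul] at hK2
    omega
  have hK0 : 1 ≤ x₀ * Fintype.card F ^ K := Nat.mul_pos hx₀1 (pow_pos Fintype.card_pos _)
  have h1 := hD (x₀ * Fintype.card F ^ K) hK0
  have h2 := hD (x₀ * Fintype.card F ^ K + z) (by omega)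
  simp only at hK3
  rw [Finset.sum_range_add] at hy h2
  have hblock := fun n (hn : n < Fintype.card F ^ K) =>
    monic_block hx₀m ((hφ.lt_pow_iff n K).1 hn)
  have hconst : ∑ n ∈ Finset.range z,
      (if (φ (x₀ * Fintype.card F ^ K + n)).Monic then
        f (φ (x₀ * Fintype.card F ^ K + n)) * ξ (φ (x₀ * Fintype.card F ^ K + n)) *
          eTheta θ (φ (x₀ * Fintype.card F ^ K + n)) else 0) =
      (∑ n ∈ Finset.range z, ψ (φ (x₀ * Fintype.card F ^ K + n))) *
        (ξ (φ x₀ * X ^ K + φ 0) * eTheta θ (φ x₀ * X ^ K + φ 0)) := by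
    rw [Finset.sum_mul]
    refine Finset.sum_congr rfl fun n hn => ?_
    have hnK := (Finset.mem_range.1 hn).trans hzK
    obtain ⟨hm, hdeg, htop⟩ := hblock n hnK
    obtain ⟨hm₀, hdeg₀, htop₀⟩ := hblock 0 (pow_pos Fintype.card_pos _)
    rw [hφ.map_mul_pow_add _ _ _ hnK, if_pos hm, ← extendModified_of_monic (f := f) hχ.1 hm,
      hξν _ _ hm hm₀ fun i hi => by rw [htop i (hi.trans hx₀ν), htop₀ i (hi.trans hx₀ν)],
      eTheta, eTheta, hdeg, hdeg₀, mul_assoc]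
  rw [hconst] at h2
  have hnorm : ‖(∑ n ∈ Finset.range z, ψ (φ (x₀ * Fintype.card F ^ K + n))) *
      (ξ (φ x₀ * X ^ K + φ 0) * eTheta θ (φ x₀ * X ^ K + φ 0))‖ =
      ‖∑ n ∈ Finset.range z, ψ (φ (x₀ * Fintype.card F ^ K + n))‖ := by
    rw [norm_mul, norm_mul, norm_eTheta,
      hξ1 _ (hblock 0 (pow_pos Fintype.card_pos _)).1, mul_one, mul_one]
  have h3 := norm_le_add_norm_add' _ _ |>.trans (add_le_add h2 h1) |> hnorm.symm.le.trans
  have h4 := norm_add_le (∑ n ∈ Finset.range (x₀ * Fintype.card F ^ K), ψ (φ n))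
    (∑ n ∈ Finset.range z, ψ (φ (x₀ * Fintype.card F ^ K + n)))
  linarith

end FFEDP

end
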